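/- Let C be a Cayley algebra over a field F with norm n. Two Cayley algebras C₁ and C₂ with norms n₁, n₂ are isomorphic as algebras if and only if the quadratic forms n₁ and n₂ are isometric. -/

import Mathlib

open QuadraticMap

set_option linter.unusedSectionVars false

namespace CayleyAux

variable {F : Type*} [Field F] {C : Type*} [NonAssocRing C] [Module F C]
  [SMulCommClass F C C] [IsScalarTower F C C]

/-- Unital composition algebra axioms for the form `n`. -/
structure Comp (n : QuadraticForm F C) : Prop where
  mul : ∀ x y, n (x * y) = n x * n y
  one : n 1 = 1
  nd : ∀ x : C, (∀ y : C, polar n x y = 0) → x = 0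
  dim : Module.finrank F C = 8

/-- The canonical conjugation. -/
def cj (n : QuadraticForm F C) (x : C) : C := polar n x 1 • (1 : C) - x

variable {n : QuadraticForm F C}

theorem Comp.mk' (hdim : Module.finrank F C = 8)
    (hmul : ∀ x y, n (x * y) = n x * n y)
    (hnd : ∀ x : C, (∀ y : C, polar n x y = 0) → x = 0) : Comp n := by
  refine ⟨hmul, ?_, hnd, hdim⟩
  have h1 : n 1 * n 1 = n 1 := by rw [← hmul, mul_one]
  rcases eq_or_ne (n 1) 0 with h0 | h0
  · exfalso
    have hz : ∀ x, n x = 0 := fun x => by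
      have := hmul x 1
      rwa [mul_one, h0, mul_zero] at this
    have hs : ∀ x : C, x = 0 := fun x => hnd x (fun y => by simp [polar, hz])
    have : Subsingleton C := ⟨fun x y => by rw [hs x, hs y]⟩
    rw [Module.finrank_zero_of_subsingleton] at hdim
    omega
  · exact mul_right_cancel₀ h0 (by rw [h1, one_mul])

theorem cj_add (x y : C) : cj n (x + y) = cj n x + cj n y := by
  simp only [cj, polar_add_left, add_smul]; abel

theorem norm_add (x y : C) : n (x + y) = n x + n y + polar n x y := by
  simp only [polar]; ring

namespace Comp

theorem ext (H : Comp n) {x y : C} (h : ∀ z, polar n x z = polar n y z) : x = y := by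
  rw [← sub_eq_zero]
  exact H.nd _ fun z => by rw [polar_sub_left, h, sub_self]

theorem one_ne (H : Comp n) : (1 : C) ≠ 0 := fun h => by
  have := H.one
  rw [h, map_zero] at this
  exact zero_ne_one this

theorem finiteDim (H : Comp n) : FiniteDimensional F C :=
  Module.finite_of_finrank_pos (by rw [H.dim]; norm_num)

theorem polar_mul_left (H : Comp n) (x y z : C) : polar n (x * y) (x * z) = n x * polar n y z := by
  simp only [polar, ← mul_add, H.mul]; ring

theorem polar_mul_right (H : Comp n) (x y z : C) : polar n (x * z) (y * z) = polar n x y * n z := by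
  simp only [polar, ← add_mul, H.mul]; ring

theorem polar_four (H : Comp n) (x y z w : C) :
    polar n (x * y) (z * w) + polar n (x * w) (z * y) = polar n x z * polar n y w := by
  have h := H.polar_mul_left (x + z) y w
  simp only [add_mul, polar_add_left, polar_add_right, H.polar_mul_left] at h
  have e : n (x + z) = n x + n z + polar n x z := by simp only [polar]; ring
  rw [e, polar_comm n (z * y) (x * w)] at h
  linear_combination h

theorem adj_left (H : Comp n) (x y z : C) : polar n (x * y) z = polar n y (cj n x * z) := by
  have h := H.polar_four x y 1 z
  simp only [one_mul] at h
  simp only [cj, sub_mul, smul_mul_assoc, one_mul, polar_sub_right, polar_smul_right,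
    smul_eq_mul]
  rw [polar_comm n y (x * z)]
  linear_combination h

theorem adj_right (H : Comp n) (x y z : C) : polar n (x * y) z = polar n x (z * cj n y) := by
  have h := H.polar_four x y z 1
  simp only [mul_one] at h
  simp only [cj, mul_sub, mul_smul_comm, mul_one, polar_sub_right, polar_smul_right,
    smul_eq_mul]
  linear_combination h

theorem norm_cj (H : Comp n) (x : C) : n (cj n x) = n x := by
  have e : n (cj n x) = n (polar n x 1 • (1 : C)) + n (-x) + polar n (polar n x 1 • (1 : C)) (-x) := by
    simp only [polar, cj, sub_eq_add_neg]; ring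
  rw [e, QuadraticMap.map_smul, QuadraticMap.map_neg, polar_neg_right, polar_smul_left, H.one,
    polar_comm n 1 x]
  simp only [smul_eq_mul]; ring

theorem polar_one_one (H : Comp n) : polar n (1 : C) 1 = 2 := by
  rw [polar_self, H.one]; simp

theorem cj_cj (H : Comp n) (x : C) : cj n (cj n x) = x := by
  have : polar n (cj n x) 1 = polar n x 1 := by
    simp only [cj, polar_sub_left, polar_smul_left, H.polar_one_one, smul_eq_mul]; ring
  rw [cj, this, cj]; abel

theorem mul_cj_mul (H : Comp n) (x y : C) : x * (cj n x * y) = n x • y := by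
  apply H.ext
  intro z
  rw [H.adj_left, H.polar_mul_left, H.norm_cj, polar_smul_left, smul_eq_mul]

theorem mul_mul_cj (H : Comp n) (x y : C) : (y * x) * cj n x = n x • y := by
  apply H.ext
  intro z
  rw [H.adj_right, H.cj_cj, H.polar_mul_right, polar_smul_left, smul_eq_mul, mul_comm]

theorem lin_left (H : Comp n) (x y z : C) :
    x * (cj n z * y) + z * (cj n x * y) = polar n x z • y := by
  have h := H.mul_cj_mul (x + z) y
  rw [cj_add, norm_add, add_mul, add_mul, mul_add, mul_add, H.mul_cj_mul, H.mul_cj_mul,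
    add_smul, add_smul] at h
  have : x * (cj n z * y) + z * (cj n x * y) =
    (n x • y + x * (cj n z * y) + (z * (cj n x * y) + n z • y)) - n x • y - n z • y := by abel
  rw [this, h]; abel

theorem lin_right (H : Comp n) (x y z : C) :
    (y * x) * cj n z + (y * z) * cj n x = polar n x z • y := by
  have h := H.mul_mul_cj (x + z) y
  rw [cj_add, norm_add, mul_add, mul_add, add_mul, add_mul, H.mul_mul_cj, H.mul_mul_cj,
    add_smul, add_smul] at h
  have : (y * x) * cj n z + (y * z) * cj n x =
    (n x • y + y * z * cj n x + (y * x * cj n z + n z • y)) - n x • y - n z • y := by abel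
  rw [this, h]; abel

theorem sq (H : Comp n) (x : C) : x * x = polar n x 1 • x - n x • (1 : C) := by
  have h := H.mul_cj_mul x 1
  rw [mul_one, cj, mul_sub, mul_smul_comm, mul_one] at h
  rw [← h]; abel

theorem polar_cj_cj (H : Comp n) (x y : C) : polar n (cj n x) (cj n y) = polar n x y := by
  simp only [polar, ← cj_add, H.norm_cj]

theorem cj_mul (H : Comp n) (x y : C) : cj n (x * y) = cj n y * cj n x := by
  apply H.ext
  intro z
  have h1 : polar n (cj n (x * y)) z = polar n (x * y) (cj n z) := by
    rw [← H.polar_cj_cj, H.cj_cj]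
  rw [h1, H.adj_right, H.adj_right (cj n y), H.cj_cj, polar_comm n (cj n y), H.adj_left]

end Comp

/-- `f` embeds the "algebra with involution" `(A, m, s)` in `C`, with nondegenerate image. -/
structure Emb {A : Type*} [AddCommGroup A] [Module F A] (n : QuadraticForm F C)
    (m : A → A → A) (s : A → A) (f : A →ₗ[F] C) : Prop where
  mul : ∀ x y, f (m x y) = f x * f y
  conj : ∀ x, f (s x) = cj n (f x)
  one : ∃ e, f e = 1
  nd : ∀ x, (∀ y, polar n (f x) (f y) = 0) → x = 0

/-- Cayley-Dickson multiplication. -/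
def cdMul {A : Type*} [AddCommGroup A] [Module F A] (m : A → A → A) (s : A → A) (γ : F)
    (p q : A × A) : A × A :=
  (m p.1 q.1 - γ • m (s q.2) p.2, m q.2 p.1 + m p.2 (s q.1))

/-- Cayley-Dickson involution. -/
def cdConj {A : Type*} [AddCommGroup A] (s : A → A) (p : A × A) : A × A := (s p.1, -p.2)

/-- The doubled map `(x, y) ↦ f x + f y * c`. -/
def cdMap {A : Type*} [AddCommGroup A] [Module F A] (f : A →ₗ[F] C) (c : C) :
    (A × A) →ₗ[F] C :=
  f.coprod ((LinearMap.mulRight F c).comp f)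

section emb
variable {A : Type*} [AddCommGroup A] [Module F A]

theorem cdMap_apply (f : A →ₗ[F] C) (c : C) (p : A × A) :
    cdMap f c p = f p.1 + f p.2 * c := by
  simp [cdMap]

variable {m : A → A → A} {s : A → A} {f : A →ₗ[F] C}

theorem Emb.orth (H : Comp n) (E : Emb n m s f) {c : C} (hc : ∀ x, polar n (f x) c = 0)
    (x y : A) : polar n (f x) (f y * c) = 0 := by
  rw [polar_comm, H.adj_left, ← E.conj, ← E.mul, polar_comm, hc]

theorem Emb.norm (H : Comp n) (E : Emb n m s f) {c : C} (hc : ∀ x, polar n (f x) c = 0)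
    (p : A × A) : n (cdMap f c p) = n (f p.1) + n (f p.2) * n c := by
  rw [cdMap_apply, norm_add, E.orth H hc, H.mul, add_zero]

theorem Emb.double (H : Comp n) (E : Emb n m s f) {c : C} (hc : ∀ x, polar n (f x) c = 0)
    (h0 : n c ≠ 0) : Emb n (cdMul m s (n c)) (cdConj s) (cdMap f c) := by
  obtain ⟨e, he⟩ := E.one
  have hc1 : polar n c 1 = 0 := by rw [polar_comm, ← he, hc]
  have hcc : cj n c = -c := by rw [cj, hc1, zero_smul, zero_sub]
  have hyc : ∀ y, cj n (f y * c) = -(f y * c) := fun y => by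
    rw [cj, polar_comm, ← he, E.orth H hc, zero_smul, zero_sub]
  -- `x c = c x̄`
  have k1 : ∀ x, f x * c = c * f (s x) := fun x => by
    have := H.cj_mul (f x) c
    rw [hyc, hcc, neg_mul, neg_inj, ← E.conj] at this
    exact this
  have k2 : ∀ x y, f x * (f y * c) = (f y * f x) * c := fun x y => by
    have h := H.lin_left (f x) (f (s y)) (-c)
    have hcc' : cj n (-c) = c := by rw [← hcc, H.cj_cj]
    rw [hcc', polar_neg_right, hc, neg_zero, zero_smul, ← k1, ← E.conj, neg_mul,
      add_neg_eq_zero, E.conj, E.conj, ← H.cj_mul, ← E.mul, ← E.conj, ← k1, E.mul] at h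
    exact h
  have k3 : ∀ y z, (f y * c) * f z = (f y * f (s z)) * c := fun y z => by
    have h := H.lin_right (f (s z)) (f y) c
    rw [hc, zero_smul, hcc, mul_neg, E.conj z, H.cj_cj, neg_add_eq_zero, ← E.conj] at h
    exact h.symm
  have k4 : ∀ y z, (f y * c) * (f z * c) = - (n c • (f (s z) * f y)) := fun y z => by
    have h := H.lin_left (f y * c) c (f (s z))
    have h2 := H.mul_mul_cj c (f y)
    rw [hcc, mul_neg] at h2
    rw [polar_comm, E.orth H hc, zero_smul, hyc, E.conj z, H.cj_cj, neg_mul, h2,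
      mul_smul_comm, ← E.conj] at h
    exact eq_neg_of_add_eq_zero_left h
  refine ⟨fun p q => ?_, fun p => ?_, ⟨(e, 0), by simp [cdMap_apply, he]⟩, fun p hp => ?_⟩
  · simp only [cdMap_apply, cdMul, map_sub, map_add, map_smul, E.mul, add_mul, mul_add, k2, k3, k4]
    abel
  · simp only [cdMap_apply, cdConj, cj_add, map_neg, E.conj, hyc, neg_mul]
  · have h1 : p.1 = 0 := E.nd _ fun y => by
      have := hp (y, 0)
      simp only [cdMap_apply, map_zero, zero_mul, add_zero, polar_add_left] at this
      rwa [polar_comm n (f p.2 * c), E.orth H hc, add_zero] at this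
    have h2 : p.2 = 0 := E.nd _ fun y => by
      have := hp (0, y)
      simp only [cdMap_apply, map_zero, zero_add, polar_add_left] at this
      rw [E.orth H hc, zero_add, H.polar_mul_right] at this
      exact (mul_eq_zero.mp this).resolve_right h0
    exact Prod.ext h1 h2

/-- existence of an anisotropic vector orthogonal to a nondegenerate subspace -/
theorem exists_orth (H : Comp n) [FiniteDimensional F A] (f : A →ₗ[F] C)
    (nd : ∀ x, (∀ y, polar n (f x) (f y) = 0) → x = 0) (hA : Module.finrank F A < 8) :
    ∃ c, (∀ x, polar n (f x) c = 0) ∧ n c ≠ 0 := by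
  have := H.finiteDim
  by_contra hcon
  push Not at hcon
  -- the orthogonal projection
  let B : C →ₗ[F] (Module.Dual F A) :=
    ((Module.Dual.transpose (R := F) f)).comp n.polarBilin
  have hB : ∀ c x, B c x = polar n c (f x) := fun c x => rfl
  have hinj : Function.Injective (B.comp f) := by
    rw [← LinearMap.ker_eq_bot, LinearMap.ker_eq_bot']
    intro x hx
    exact nd x fun y => by rw [← hB]; exact LinearMap.congr_fun hx y
  have hsurj : Function.Surjective (B.comp f) :=
    (LinearMap.injective_iff_surjective_of_finrank_eq_finrank
      (Subspace.dual_finrank_eq).symm).mp hinj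
  -- every orthogonal vector is zero
  have hz : ∀ c, (∀ x, polar n (f x) c = 0) → c = 0 := by
    intro c hc
    apply H.nd
    intro y
    obtain ⟨x, hx⟩ := hsurj (B y)
    have hd : ∀ z, polar n (f z) (y - f x) = 0 := fun z => by
      rw [polar_comm, polar_sub_left, ← hB, ← hB, ← hx]; simp
    have e : y = (y - f x) + f x := by abel
    rw [e, polar_add_right, polar_comm n c (f x), hc, add_zero]
    have hs : ∀ z, polar n (f z) (c + (y - f x)) = 0 := fun z => by
      rw [polar_add_right, hc, hd, add_zero]
    simp only [polar]
    rw [hcon _ hs, hcon _ hc, hcon _ hd]; simp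
  have hBinj : Function.Injective B := by
    rw [← LinearMap.ker_eq_bot, LinearMap.ker_eq_bot']
    intro c hc
    exact hz c fun x => by rw [polar_comm, ← hB, hc]; rfl
  have := LinearMap.finrank_le_finrank_of_injective hBinj
  rw [Subspace.dual_finrank_eq, H.dim] at this
  omega

theorem Emb.bijective (H : Comp n) (E : Emb n m s f) (hA : Module.finrank F A = 8) :
    Function.Bijective f := by
  have := H.finiteDim
  have : FiniteDimensional F A := Module.finite_of_finrank_pos (by omega)
  have hi : Function.Injective f := by
    rw [← LinearMap.ker_eq_bot, LinearMap.ker_eq_bot']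
    intro x hx
    exact E.nd x fun y => by rw [hx, polar_zero_left]
  exact ⟨hi, (LinearMap.injective_iff_surjective_of_finrank_eq_finrank (by rw [hA, H.dim])).mp hi⟩

end emb

/-- multiplication of the quadratic algebra `a² = a - α` -/
def kMul (α : F) (p q : F × F) : F × F :=
  (p.1 * q.1 - α * (p.2 * q.2), p.1 * q.2 + p.2 * q.1 + p.2 * q.2)

/-- conjugation on the quadratic algebra -/
def kConj (p : F × F) : F × F := (p.1 + p.2, -p.2)

/-- embedding of the quadratic algebra -/
def kMap (a : C) : (F × F) →ₗ[F] C :=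
  (LinearMap.toSpanSingleton F C 1).coprod (LinearMap.toSpanSingleton F C a)

theorem kMap_apply (a : C) (p : F × F) : kMap a p = p.1 • (1 : C) + p.2 • a := by
  simp [kMap]

theorem kNorm (H : Comp n) {a : C} (ha : polar n a 1 = 1) (p : F × F) :
    n (kMap a p) = p.1 * p.1 + p.1 * p.2 + n a * (p.2 * p.2) := by
  rw [kMap_apply, norm_add, QuadraticMap.map_smul, QuadraticMap.map_smul, H.one,
    polar_smul_left, polar_smul_right, polar_comm, ha]
  simp only [smul_eq_mul]; ring

theorem kEmb (H : Comp n) {a : C} (ha : polar n a 1 = 1) (hd : 1 - 4 * n a ≠ 0) :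
    Emb n (kMul (n a)) kConj (kMap a) := by
  refine ⟨fun p q => ?_, fun p => ?_, ⟨(1, 0), by simp [kMap_apply]⟩, fun p hp => ?_⟩
  · have h := H.sq a
    rw [ha, one_smul] at h
    simp only [kMap_apply, kMul, add_mul, mul_add, smul_mul_assoc, mul_smul_comm, one_mul,
      mul_one, h]
    module
  · simp only [kMap_apply, kConj, cj, polar_add_left, polar_smul_left, ha, H.polar_one_one,
      smul_eq_mul]
    module
  · have h1 := hp (1, 0)
    have h2 := hp (0, 1)
    have ha' : polar n 1 a = 1 := by rw [polar_comm, ha]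
    simp only [kMap_apply, one_smul, zero_smul, add_zero, zero_add, polar_add_left,
      polar_smul_left, ha, ha', H.polar_one_one, polar_self, smul_eq_mul, nsmul_eq_mul,
      Nat.cast_ofNat] at h1 h2
    have e1 : p.1 = 0 := by
      have : (1 - 4 * n a) * p.1 = 0 := by linear_combination h2 - 2 * n a * h1
      exact (mul_eq_zero.mp this).resolve_left hd
    have e2 : p.2 = 0 := by rw [e1] at h1; simpa using h1
    exact Prod.ext e1 e2

theorem exists_polar_eq_one (H : Comp n) {x : C} (hx : x ≠ 0) : ∃ y, polar n x y = 1 := by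
  have : ∃ y, polar n x y ≠ 0 := by
    by_contra h
    push Not at h
    exact hx (H.nd x h)
  obtain ⟨y, hy⟩ := this
  exact ⟨(polar n x y)⁻¹ • y, by rw [polar_smul_right, smul_eq_mul, inv_mul_cancel₀ hy]⟩

theorem exists_a (H : Comp n) : ∃ a : C, polar n a 1 = 1 ∧ 1 - 4 * n a ≠ 0 := by
  by_cases h2 : (2 : F) = 0
  · obtain ⟨a, ha⟩ := exists_polar_eq_one H H.one_ne
    refine ⟨a, by rw [polar_comm, ha], ?_⟩
    have : (4 : F) = 2 * 2 := by norm_num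
    rw [this, h2]; simp
  · obtain ⟨w, hw, hn⟩ := exists_orth H (LinearMap.toSpanSingleton F C 1) (fun x hx => by
      have := hx 1
      simp only [LinearMap.toSpanSingleton_apply, polar_smul_left, one_smul, H.polar_one_one,
        smul_eq_mul] at this
      exact (mul_eq_zero.mp this).resolve_right h2) (by simp)
    have hw1 : polar n 1 w = 0 := by simpa using hw 1
    refine ⟨(2 : F)⁻¹ • (1 : C) + w, ?_, ?_⟩
    · rw [polar_add_left, polar_smul_left, H.polar_one_one, polar_comm n w, hw1, smul_eq_mul,
        inv_mul_cancel₀ h2, add_zero]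
    · rw [norm_add, QuadraticMap.map_smul, H.one, polar_smul_left, hw1]
      have : (1 : F) - 4 * (((2 : F)⁻¹ * 2⁻¹) • (1:F) + n w + (2 : F)⁻¹ • (0 : F)) = -(2 * 2) * n w := by
        simp only [smul_eq_mul]
        field_simp
        ring
      rw [this]
      exact mul_ne_zero (neg_ne_zero.mpr (mul_ne_zero h2 h2)) hn

section split
variable {A : Type*} [AddCommGroup A] [Module F A] {m : A → A → A} {s : A → A} {f : A →ₗ[F] C}

theorem Emb.exists_one (H : Comp n) (E : Emb n m s f) [FiniteDimensional F A]
    (hA : Module.finrank F A < 8) (hu : ∀ r : F, ∃ p, n (f p) = r) :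
    ∃ c, (∀ x, polar n (f x) c = 0) ∧ n c = 1 := by
  obtain ⟨c, hc, h0⟩ := exists_orth H f E.nd hA
  obtain ⟨p, hp⟩ := hu (n c)⁻¹
  exact ⟨f p * c, fun x => E.orth H hc x p, by rw [H.mul, hp, inv_mul_cancel₀ h0]⟩

end split

theorem split_emb (H : Comp n) {x : C} (hx : x ≠ 0) (hnx : n x = 0) :
    ∃ f : (((F × F) × (F × F)) × ((F × F) × (F × F))) →ₗ[F] C,
      Emb n (cdMul (cdMul (kMul 0) kConj (1 : F)) (cdConj kConj) (1 : F))
        (cdConj (cdConj kConj)) f := by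
  obtain ⟨y, hy⟩ := exists_polar_eq_one H hx
  have ha : polar n (x * cj n y) 1 = 1 := by rw [H.adj_right, H.cj_cj, one_mul, hy]
  have hna : n (x * cj n y) = 0 := by rw [H.mul, hnx, zero_mul]
  have E := kEmb H ha (by rw [hna]; simp)
  have hu : ∀ r : F, ∃ p : F × F, n (kMap (x * cj n y) p) = r := fun r =>
    ⟨(1, r - 1), by rw [kNorm H ha, hna]; ring⟩
  rw [hna] at E
  obtain ⟨b, hb, hb1⟩ := E.exists_one H (by simp) hu
  have E2 := E.double H hb (by rw [hb1]; exact one_ne_zero)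
  rw [hb1] at E2
  have hu2 : ∀ r : F, ∃ p : (F × F) × (F × F), n (cdMap (kMap (x * cj n y)) b p) = r := fun r => by
    obtain ⟨p, hp⟩ := hu r
    exact ⟨(p, 0), by rw [E.norm H hb]; simp [hp]⟩
  obtain ⟨c, hc, hc1⟩ := E2.exists_one H (by simp) hu2
  have E3 := E2.double H hc (by rw [hc1]; exact one_ne_zero)
  rw [hc1] at E3
  exact ⟨_, E3⟩

/-- One reflection in an anisotropic space. -/
theorem reflect (haniso : ∀ x : C, n x = 0 → x = 0) (u v : C) (huv : n u = n v) :
    ∃ σ : C →ₗ[F] C, (∀ x, n (σ x) = n x) ∧ σ u = v ∧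
      ∀ w, polar n u w = polar n v w → σ w = w := by
  by_cases h : u = v
  · exact ⟨LinearMap.id, fun _ => rfl, h, fun _ _ => rfl⟩
  have h0 : n (u - v) ≠ 0 := fun h' => h (sub_eq_zero.mp (haniso _ h'))
  let σ : C →ₗ[F] C := LinearMap.id -
    (n (u - v))⁻¹ • (n.polarBilin (u - v)).smulRight (u - v)
  have hσ : ∀ x, σ x = x - ((n (u - v))⁻¹ * polar n (u - v) x) • (u - v) := fun x => by
    simp [σ, mul_smul]
  refine ⟨σ, fun x => ?_, ?_, fun w hw => ?_⟩
  · rw [hσ, sub_eq_add_neg, ← neg_smul, norm_add, QuadraticMap.map_smul, polar_smul_right,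
      polar_comm n x]
    simp only [smul_eq_mul]
    field_simp
    ring
  · have e1 : polar n (u - v) u = n (u - v) := by
      have e : n (u - v) = n u + n v - polar n u v := by
        rw [sub_eq_add_neg, norm_add, QuadraticMap.map_neg, polar_neg_right]; ring
      rw [e, polar_sub_left, polar_self, polar_comm n v u, ← huv]
      simp only [nsmul_eq_mul, Nat.cast_ofNat]; ring
    rw [hσ, e1, inv_mul_cancel₀ h0, one_smul]; abel
  · rw [hσ, polar_sub_left, hw, sub_self, mul_zero, zero_smul, sub_zero]

section two
variable {C₂ : Type*} [NonAssocRing C₂] [Module F C₂] [SMulCommClass F C₂ C₂]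
  [IsScalarTower F C₂ C₂] {n₂ : QuadraticForm F C₂}

theorem iso_of_emb {A : Type*} [AddCommGroup A] [Module F A] {m : A → A → A} {s : A → A}
    {f : A →ₗ[F] C} {g : A →ₗ[F] C₂} (H : Comp n) (H₂ : Comp n₂)
    (E : Emb n m s f) (E₂ : Emb n₂ m s g) (hA : Module.finrank F A = 8) :
    ∃ φ : C ≃ₗ[F] C₂, ∀ x y : C, φ (x * y) = φ x * φ y := by
  let e := LinearEquiv.ofBijective f (E.bijective H hA)
  let e₂ := LinearEquiv.ofBijective g (E₂.bijective H₂ hA)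
  refine ⟨e.symm.trans e₂, fun x y => ?_⟩
  obtain ⟨p, rfl⟩ := e.surjective x
  obtain ⟨q, rfl⟩ := e.surjective y
  have : e p * e q = e (m p q) := (E.mul p q).symm
  rw [this]
  simp only [LinearEquiv.trans_apply, LinearEquiv.symm_apply_apply]
  exact E₂.mul p q

theorem aniso_iso (H : Comp n) (H₂ : Comp n₂) (haniso : ∀ x : C₂, n₂ x = 0 → x = 0)
    (φ₀ : C →ₗ[F] C₂) (hφ₀ : ∀ x, n₂ (φ₀ x) = n x) :
    ∃ φ : C ≃ₗ[F] C₂, ∀ x y : C, φ (x * y) = φ x * φ y := by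
  -- normalise so that `φ 1 = 1`
  obtain ⟨φ, hφ, hφ1⟩ : ∃ φ : C →ₗ[F] C₂, (∀ x, n₂ (φ x) = n x) ∧ φ 1 = 1 := by
    obtain ⟨σ, h1, h2, -⟩ := reflect haniso (φ₀ 1) 1 (by rw [hφ₀, H.one, H₂.one])
    exact ⟨σ.comp φ₀, fun x => by simp [h1, hφ₀], by simp [h2]⟩
  have hp : ∀ x y, polar n₂ (φ x) (φ y) = polar n x y := fun x y => by
    simp only [polar, ← map_add, hφ]
  obtain ⟨a, ha, hd⟩ := exists_a H
  have ha₂ : polar n₂ (φ a) 1 = 1 := by rw [← hφ1, hp, ha]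
  have E := kEmb H ha hd
  have E₂ := kEmb H₂ ha₂ (by rwa [hφ])
  rw [hφ] at E₂
  have hk : ∀ p : F × F, kMap (φ a) p = φ (kMap a p) := fun p => by
    simp [kMap_apply, hφ1]
  obtain ⟨b, hb, hb0⟩ := exists_orth H _ E.nd (by simp)
  have hb₂ : ∀ x : F × F, polar n₂ (kMap (φ a) x) (φ b) = 0 := fun x => by rw [hk, hp, hb]
  have D := E.double H hb hb0
  have D₂ := E₂.double H₂ hb₂ (by rwa [hφ])
  rw [hφ] at D₂
  have hN : ∀ p : (F × F) × (F × F), n₂ (cdMap (kMap (φ a)) (φ b) p) = n (cdMap (kMap a) b p) := fun p => by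
    rw [E.norm H hb, E₂.norm H₂ hb₂, hk, hk, hφ, hφ, hφ]
  have hP : ∀ p q : (F × F) × (F × F), polar n₂ (cdMap (kMap (φ a)) (φ b) p) (cdMap (kMap (φ a)) (φ b) q) =
      polar n (cdMap (kMap a) b p) (cdMap (kMap a) b q) := fun p q => by
    simp only [polar, ← map_add, hN]
  obtain ⟨σ, hσ, hσ1, hσ2⟩ := reflect haniso (φ (a * b)) (φ a * φ b)
    (by rw [hφ, H.mul, H₂.mul, hφ, hφ])
  have hfix : ∀ p : (F × F) × (F × F), cdMap (kMap (φ a)) (φ b) p = φ (cdMap (kMap a) b p) →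
      σ (φ (cdMap (kMap a) b p)) = φ (cdMap (kMap a) b p) := fun p h => by
    apply hσ2
    have e1 : a * b = cdMap (kMap a) b (((0, 0), (0, 1)) : (F × F) × (F × F)) := by simp [cdMap_apply, kMap_apply]
    have e2 : φ a * φ b = cdMap (kMap (φ a)) (φ b) (((0, 0), (0, 1)) : (F × F) × (F × F)) := by
      simp [cdMap_apply, kMap_apply]
    rw [hp, e1, e2, ← h, hP]
  have s1 : σ 1 = 1 := by
    have := hfix ((1, 0), (0, 0)) (by simp [cdMap_apply, kMap_apply, hφ1])
    simpa [cdMap_apply, kMap_apply, hφ1] using this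
  have sa : σ (φ a) = φ a := by
    have := hfix ((0, 1), (0, 0)) (by simp [cdMap_apply, kMap_apply])
    simpa [cdMap_apply, kMap_apply] using this
  have sb : σ (φ b) = φ b := by
    have := hfix ((0, 0), (1, 0)) (by simp [cdMap_apply, kMap_apply])
    simpa [cdMap_apply, kMap_apply] using this
  have key : ∀ p : (F × F) × (F × F), cdMap (kMap (φ a)) (φ b) p = σ (φ (cdMap (kMap a) b p)) := fun p => by
    simp only [cdMap_apply, kMap_apply, add_mul, smul_mul_assoc, one_mul, map_add, map_smul,
      hφ1, s1, sa, sb, hσ1]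
  have hpσ : ∀ x y, polar n₂ (σ (φ x)) (σ (φ y)) = polar n x y := fun x y => by
    simp only [polar, ← map_add, hφ, hσ]
  obtain ⟨c, hc, hc0⟩ := exists_orth H _ D.nd (by simp)
  have hnc : n₂ (σ (φ c)) = n c := by rw [hσ, hφ]
  have O := D.double H hc hc0
  have O₂ := D₂.double H₂ (c := σ (φ c)) (fun x => by rw [key, hpσ, hc]) (by rwa [hnc])
  rw [hnc] at O₂
  exact iso_of_emb H H₂ O O₂ (by simp)

theorem norm_of_iso (H : Comp n) (H₂ : Comp n₂) (φ : C ≃ₗ[F] C₂)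
    (hφ : ∀ x y : C, φ (x * y) = φ x * φ y) (x : C) : n₂ (φ x) = n x := by
  have h1 : φ 1 = 1 := by
    obtain ⟨e, he⟩ := φ.surjective 1
    have := hφ 1 e
    rw [one_mul, he, mul_one] at this
    exact this.symm
  by_cases hx : ∃ r : F, x = r • (1 : C)
  · obtain ⟨r, rfl⟩ := hx
    rw [map_smul, h1, QuadraticMap.map_smul, QuadraticMap.map_smul, H.one, H₂.one]
  have e := H₂.sq (φ x)
  rw [← hφ, H.sq x, ← h1, ← map_smul, ← map_smul, ← map_sub, φ.injective.eq_iff] at e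
  have e' : (polar n x 1 - polar n₂ (φ x) (φ 1)) • x = (n x - n₂ (φ x)) • (1 : C) := by
    have e3 : (polar n x 1 - polar n₂ (φ x) (φ 1)) • x - (n x - n₂ (φ x)) • (1 : C) =
      (polar n x 1 • x - n x • (1 : C)) -
        (polar n₂ (φ x) (φ 1) • x - n₂ (φ x) • (1 : C)) := by module
    rw [← sub_eq_zero, e3, e, sub_self]
  by_cases ht : polar n x 1 - polar n₂ (φ x) (φ 1) = 0
  · rw [ht, zero_smul] at e'
    have := (smul_eq_zero.mp e'.symm).resolve_right H.one_ne
    exact (sub_eq_zero.mp this).symm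
  · exact absurd ⟨_, by rw [mul_smul, ← e', inv_smul_smul₀ ht]⟩ hx

end two

end CayleyAux

/-- Two Cayley algebras `C₁`, `C₂` over `F`, with norms `n₁`, `n₂`, are
isomorphic as algebras if and only if the quadratic forms `n₁` and `n₂` are isometric. -/
theorem cayley_isomorphic_iff_norms_isometric {F : Type*} [Field F]
    {C₁ : Type*} [NonAssocRing C₁] [Module F C₁] [SMulCommClass F C₁ C₁]
    [IsScalarTower F C₁ C₁]
    {C₂ : Type*} [NonAssocRing C₂] [Module F C₂] [SMulCommClass F C₂ C₂]
    [IsScalarTower F C₂ C₂]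
    (n₁ : QuadraticForm F C₁) (n₂ : QuadraticForm F C₂)
    (hdim₁ : Module.finrank F C₁ = 8) (hdim₂ : Module.finrank F C₂ = 8)
    (hcomp₁ : ∀ x y : C₁, n₁ (x * y) = n₁ x * n₁ y)
    (hcomp₂ : ∀ x y : C₂, n₂ (x * y) = n₂ x * n₂ y)
    (hnd₁ : ∀ x : C₁, (∀ y : C₁, polar (⇑n₁) x y = 0) → x = 0)
    (hnd₂ : ∀ x : C₂, (∀ y : C₂, polar (⇑n₂) x y = 0) → x = 0)
    (halt₁ : ∀ x y : C₁, x * (x * y) = (x * x) * y ∧ (x * y) * y = x * (y * y))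
    (halt₂ : ∀ x y : C₂, x * (x * y) = (x * x) * y ∧ (x * y) * y = x * (y * y)) :
    (∃ φ : C₁ ≃ₗ[F] C₂, ∀ x y : C₁, φ (x * y) = φ x * φ y) ↔
      (∃ φ : C₁ ≃ₗ[F] C₂, ∀ x : C₁, n₂ (φ x) = n₁ x) := by
  have H₁ : CayleyAux.Comp n₁ := CayleyAux.Comp.mk' hdim₁ hcomp₁ hnd₁
  have H₂ : CayleyAux.Comp n₂ := CayleyAux.Comp.mk' hdim₂ hcomp₂ hnd₂
  constructor
  · rintro ⟨φ, hφ⟩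
    exact ⟨φ, CayleyAux.norm_of_iso H₁ H₂ φ hφ⟩
  · rintro ⟨φ, hφ⟩
    by_cases haniso : ∀ x : C₂, n₂ x = 0 → x = 0
    · exact CayleyAux.aniso_iso H₁ H₂ haniso φ.toLinearMap hφ
    · push Not at haniso
      obtain ⟨x, hx, hx0⟩ := haniso
      obtain ⟨g, E₂⟩ := CayleyAux.split_emb H₂ hx0 hx
      obtain ⟨f, E₁⟩ := CayleyAux.split_emb H₁ (x := φ.symm x) (by simpa using hx0)
        (by rw [← hφ, LinearEquiv.apply_symm_apply, hx])
      exact CayleyAux.iso_of_emb H₁ H₂ E₁ E₂ (by simp)
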